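/- Let γ = (ξ,η) ∈ 𝒢, let D, T ∈ ℕ* with 3 ≤ D ≤ T ≤ C(⌊D/3⌋+1, 2), and let α = (α₀,α₁,α₂) ∈ ℂ³ with ‖α‖ = 1 and dist(α,(1:γ)) ≤ (2c₂(γ))⁻¹ (so that α₀ ≠ 0). Then dist(α,A_γ) ≤ c₄·c₅^T·T^{6T·log(T)}·|I^{(γ,T)}_D|_α, where c₄ = 3c₂(γ)·exp(2c₂(γ)²), c₅ = (2c₂(γ)+3)·c₃(γ)², c₂(γ) = max{1,|ξ|,|η|} and c₃(γ) = (2+|ξ|+|η|⁻¹)·c₂(γ). -/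

import Mathlib

open MvPolynomial

/-- The derivation `𝒟 = X₀·∂/∂X₁ + X₂·∂/∂X₂` of `ℂ[X₀,X₁,X₂]`. -/
noncomputable def DD : MvPolynomial (Fin 3) ℂ → MvPolynomial (Fin 3) ℂ :=
  fun P => X 0 * pderiv 1 P + X 2 * pderiv 2 P

/-- The norm of a polynomial: the max of the absolute values of its coefficients. -/
noncomputable def pnorm (P : MvPolynomial (Fin 3) ℂ) : ℝ :=
  ((P.support.sup fun v => ‖P.coeff v‖₊ : NNReal) : ℝ)

/-- The length of a polynomial: the sum of the absolute values of its coefficients. -/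
noncomputable def plen (P : MvPolynomial (Fin 3) ℂ) : ℝ :=
  ∑ v ∈ P.support, ‖P.coeff v‖

/-- The automorphism `τ_γ` of `ℂ[X₀,X₁,X₂]`, `τ_γ(P)(X₀,X₁,X₂) = P(X₀, ξX₀+X₁, ηX₂)`. -/
noncomputable def tauG (ξ η : ℂ) : MvPolynomial (Fin 3) ℂ →ₐ[ℂ] MvPolynomial (Fin 3) ℂ :=
  aeval ![X 0, C ξ * X 0 + X 1, C η * X 2]

/-- The ideal `I^{(γ,T)}` generated by the homogeneous polynomials all of whose
derivatives `𝒟^i P`, `0 ≤ i < T`, vanish at `(1,ξ,η)`. -/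
noncomputable def Igam (ξ η : ℂ) (T : ℕ) : Ideal (MvPolynomial (Fin 3) ℂ) :=
  Ideal.span {P | (∃ d, P.IsHomogeneous d) ∧ ∀ i < T, eval ![1, ξ, η] (DD^[i] P) = 0}

noncomputable def c2c (ξ η : ℂ) : ℝ := max 1 (max ‖ξ‖ ‖η‖)

noncomputable def c3c (ξ η : ℂ) : ℝ := (2 + ‖ξ‖ + ‖η‖⁻¹) * c2c ξ η

noncomputable def c4c (ξ η : ℂ) : ℝ := 3 * c2c ξ η * Real.exp (2 * (c2c ξ η) ^ 2)

noncomputable def c5c (ξ η : ℂ) : ℝ := (2 * c2c ξ η + 3) * (c3c ξ η) ^ 2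

/-- Projective distance from `α` (of norm 1) to the point `(1:ξ:η)`. -/
noncomputable def pdist (ξ η α₀ α₁ α₂ : ℂ) : ℝ :=
  (c2c ξ η)⁻¹ * max ‖α₁ - α₀ * ξ‖ (max ‖α₂ - α₀ * η‖ ‖α₁ * η - α₂ * ξ‖)

/-- Distance from `α` to the analytic curve `A_γ = {(1:ξ+z:ηe^z)}`. -/
noncomputable def adist (ξ η α₀ α₁ α₂ : ℂ) : ℝ :=
  ‖α₂ / α₀ - η * Complex.exp (α₁ / α₀ - ξ)‖

/-- `|I^{(γ,T)}_D|_α = sup{|P(α)| : P ∈ I^{(γ,T)}_D, ‖P‖ ≤ 1}`. -/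
noncomputable def Isup (ξ η : ℂ) (T D : ℕ) (α : Fin 3 → ℂ) : ℝ :=
  sSup {x : ℝ | ∃ P : MvPolynomial (Fin 3) ℂ,
    P ∈ Igam ξ η T ∧ P.IsHomogeneous D ∧ pnorm P ≤ 1 ∧ x = ‖eval α P‖}

/-- `DD` as a bundled derivation. -/
noncomputable def derivDD : Derivation ℂ (MvPolynomial (Fin 3) ℂ) (MvPolynomial (Fin 3) ℂ) :=
  (X 0 : MvPolynomial (Fin 3) ℂ) • pderiv 1 + (X 2 : MvPolynomial (Fin 3) ℂ) • pderiv 2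

/-- `DD` as a linear endomorphism. -/
noncomputable def endDD : Module.End ℂ (MvPolynomial (Fin 3) ℂ) := derivDD.toLinearMap

lemma endDD_apply (P : MvPolynomial (Fin 3) ℂ) : endDD P = DD P := by
  simp [endDD, derivDD, DD]

lemma endDD_mul (P Q : MvPolynomial (Fin 3) ℂ) :
    endDD (P * Q) = P * endDD Q + Q * endDD P := by
  simp [endDD]

lemma endDD_pow (P : MvPolynomial (Fin 3) ℂ) (n : ℕ) :
    endDD (P ^ (n + 1)) = (n + 1 : ℂ) • (P ^ n * endDD P) := by
  have h := derivDD.leibniz_pow P (n + 1)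
  rw [← Nat.cast_smul_eq_nsmul ℂ] at h
  simp only [Nat.cast_add, Nat.cast_one, Nat.add_sub_cancel, smul_eq_mul] at h
  exact h

lemma endDD_C (a : ℂ) : endDD (C a) = 0 := by
  simp [endDD_apply, DD]

lemma endDD_X0 : endDD (X 0) = 0 := by
  simp [endDD_apply, DD, pderiv_X]

lemma endDD_X1 : endDD (X 1) = X 0 := by
  simp [endDD_apply, DD, pderiv_X]

lemma endDD_X2 : endDD (X 2) = X 2 := by
  simp [endDD_apply, DD, pderiv_X]

/-- The `j`-th derivative along the curve at the point `(1,ξ,η)`. -/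
noncomputable def jet (ξ η : ℂ) (j : ℕ) : MvPolynomial (Fin 3) ℂ →ₗ[ℂ] ℂ :=
  (aeval ![1, ξ, η]).toLinearMap ∘ₗ (endDD ^ j)

lemma jet_apply (ξ η : ℂ) (j : ℕ) (P : MvPolynomial (Fin 3) ℂ) :
    jet ξ η j P = eval ![1, ξ, η] ((endDD ^ j) P) := by
  simp [jet, aeval_eq_eval]

lemma jet_eq_iterate (ξ η : ℂ) (j : ℕ) (P : MvPolynomial (Fin 3) ℂ) :
    jet ξ η j P = eval ![1, ξ, η] (DD^[j] P) := by
  rw [jet_apply, Module.End.pow_apply]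
  have : ⇑endDD = DD := funext endDD_apply
  rw [this]

lemma mem_Igam {ξ η : ℂ} {T d : ℕ} {P : MvPolynomial (Fin 3) ℂ} (hP : P.IsHomogeneous d)
    (h : ∀ j < T, jet ξ η j P = 0) : P ∈ Igam ξ η T :=
  Ideal.subset_span ⟨⟨d, hP⟩, fun j hj => by rw [← jet_eq_iterate]; exact h j hj⟩

lemma endDD_pow_X0_mul (j : ℕ) (P : MvPolynomial (Fin 3) ℂ) :
    (endDD ^ j) (X 0 * P) = X 0 * (endDD ^ j) P := by
  induction j with
  | zero => simp
  | succ j ih => simp [pow_succ', ih, endDD_mul, endDD_X0]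

lemma jet_X0_mul (ξ η : ℂ) (j : ℕ) (P : MvPolynomial (Fin 3) ℂ) :
    jet ξ η j (X 0 * P) = jet ξ η j P := by
  simp [jet_apply, endDD_pow_X0_mul]

lemma jet_X0_pow_mul (ξ η : ℂ) (n j : ℕ) (P : MvPolynomial (Fin 3) ℂ) :
    jet ξ η j (X 0 ^ n * P) = jet ξ η j P := by
  induction n with
  | zero => simp
  | succ n ih => rw [pow_succ', mul_assoc, jet_X0_mul, ih]

/-- The linear form `X₁ - ξX₀`, vanishing at `(1,ξ,η)`. -/
noncomputable def linU (ξ : ℂ) : MvPolynomial (Fin 3) ℂ := X 1 - C ξ * X 0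

/-- The linear form `η⁻¹X₂`, equal to one at `(1,ξ,η)`. -/
noncomputable def linV (η : ℂ) : MvPolynomial (Fin 3) ℂ := C η⁻¹ * X 2

lemma endDD_linU (ξ : ℂ) : endDD (linU ξ) = X 0 := by
  simp [linU, endDD_mul, endDD_X0, endDD_X1, endDD_C]

lemma endDD_linV (η : ℂ) : endDD (linV η) = linV η := by
  simp [linV, endDD_mul, endDD_X2, endDD_C]

lemma endDD_pow_linU_mul (ξ : ℂ) (j : ℕ) (P : MvPolynomial (Fin 3) ℂ) :
    (endDD ^ (j + 1)) (linU ξ * P) =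
      linU ξ * (endDD ^ (j + 1)) P + (j + 1 : ℂ) • (X 0 * (endDD ^ j) P) := by
  induction j with
  | zero => simp [endDD_mul, endDD_linU]; ring
  | succ j ih =>
    have hs (n : ℕ) (Q : MvPolynomial (Fin 3) ℂ) :
        (endDD ^ (n + 1)) Q = endDD ((endDD ^ n) Q) := by
      rw [pow_succ', Module.End.mul_apply]
    rw [hs (j + 1), ih, map_add, map_smul, endDD_mul, endDD_mul, endDD_X0, endDD_linU,
      hs (j + 1), hs j]
    simp only [smul_eq_C_mul, Nat.cast_add, Nat.cast_one, map_add, map_one]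
    ring

lemma jet_zero_linU_mul (ξ η : ℂ) (P : MvPolynomial (Fin 3) ℂ) :
    jet ξ η 0 (linU ξ * P) = 0 := by
  simp [jet_apply, linU]

lemma jet_succ_linU_mul (ξ η : ℂ) (j : ℕ) (P : MvPolynomial (Fin 3) ℂ) :
    jet ξ η (j + 1) (linU ξ * P) = (j + 1) * jet ξ η j P := by
  rw [jet_apply, endDD_pow_linU_mul]
  simp [jet_apply, linU, smul_eval]

lemma jet_linV (ξ : ℂ) {η : ℂ} (hη : η ≠ 0) (j : ℕ) : jet ξ η j (linV η) = 1 := by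
  have : (endDD ^ j) (linV η) = linV η := by
    induction j with
    | zero => simp
    | succ j ih => rw [pow_succ', Module.End.mul_apply, ih, endDD_linV]
  rw [jet_apply, this]
  simp [linV, hη]

lemma jet_one (ξ η : ℂ) (j : ℕ) : jet ξ η j 1 = if j = 0 then 1 else 0 := by
  cases j with
  | zero => simp [jet_apply]
  | succ j =>
    have : endDD 1 = 0 := by simpa using endDD_C 1
    simp [jet_apply, pow_succ, this]

/-- The polynomial of degree `d` whose restriction to the curve is `t ^ k / k! * exp (a t)`. -/
noncomputable def expMono (ξ η : ℂ) (d k a : ℕ) : MvPolynomial (Fin 3) ℂ :=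
  C ((k.factorial : ℂ)⁻¹) * (linU ξ ^ k * linV η ^ a * X 0 ^ (d - k - a))

lemma endDD_linV_pow (η : ℂ) (a : ℕ) : endDD (linV η ^ a) = C (a : ℂ) * linV η ^ a := by
  cases a with
  | zero => simpa using endDD_C 1
  | succ a => rw [endDD_pow, endDD_linV, smul_eq_C_mul]; simp [pow_succ]

lemma endDD_X0_pow (a : ℕ) : endDD (X 0 ^ a) = 0 := by
  cases a with
  | zero => simpa using endDD_C 1
  | succ a => rw [endDD_pow, endDD_X0]; simp

lemma endDD_expMono_zero (ξ η : ℂ) (d a : ℕ) :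
    endDD (expMono ξ η d 0 a) = C (a : ℂ) * expMono ξ η d 0 a := by
  simp only [expMono, Nat.factorial_zero, pow_zero, endDD_mul, endDD_C, endDD_X0_pow,
    endDD_linV_pow, one_mul]
  ring

lemma endDD_expMono_succ (ξ η : ℂ) {d k a : ℕ} (h : k + 1 + a ≤ d) :
    endDD (expMono ξ η d (k + 1) a) =
      C (a : ℂ) * expMono ξ η d (k + 1) a + expMono ξ η d k a := by
  obtain ⟨e, rfl⟩ := Nat.exists_eq_add_of_le h
  have h1 : k + 1 + a + e - (k + 1) - a = e := by omega
  have h2 : k + 1 + a + e - k - a = e + 1 := by omega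
  have h3 : ((k.factorial : ℂ)⁻¹) = (((k + 1).factorial : ℂ)⁻¹) * (k + 1) := by
    have : (k.factorial : ℂ) ≠ 0 := by exact_mod_cast k.factorial_ne_zero
    have : (k + 1 : ℂ) ≠ 0 := by exact_mod_cast k.succ_ne_zero
    rw [Nat.factorial_succ]; push_cast; field_simp
  simp only [expMono, h1, h2, h3, endDD_mul, endDD_C, endDD_X0_pow,
    endDD_linV_pow, endDD_pow, endDD_linU, smul_eq_C_mul, C_mul]
  ring

lemma isHomogeneous_linU (ξ : ℂ) : (linU ξ).IsHomogeneous 1 :=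
  (isHomogeneous_X _ _).sub
    (by simpa using (isHomogeneous_C _ ξ).mul (isHomogeneous_X ℂ (0 : Fin 3)))

lemma isHomogeneous_linV (η : ℂ) : (linV η).IsHomogeneous 1 := by
  simpa [linV] using (isHomogeneous_C _ η⁻¹).mul (isHomogeneous_X ℂ (2 : Fin 3))

lemma isHomogeneous_expMono (ξ η : ℂ) {d k a : ℕ} (h : k + a ≤ d) :
    (expMono ξ η d k a).IsHomogeneous d := by
  have := (isHomogeneous_C (Fin 3) ((k.factorial : ℂ)⁻¹)).mul
    ((((isHomogeneous_linU ξ).pow k).mul ((isHomogeneous_linV η).pow a)).mul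
      ((isHomogeneous_X ℂ (0 : Fin 3)).pow (d - k - a)))
  have hd : 0 + (1 * k + 1 * a + 1 * (d - k - a)) = d := by omega
  rwa [hd] at this

/-- The divided difference of `s ↦ exp (s t)` at the nodes `⌊i/q⌋, …, ⌊(i+k)/q⌋`,
as a polynomial of degree `d` restricted to the curve. -/
noncomputable def dividedDiff (ξ η : ℂ) (q d : ℕ) : ℕ → ℕ → MvPolynomial (Fin 3) ℂ
  | 0, i => expMono ξ η d 0 (i / q)
  | k + 1, i =>
    if i / q = (i + k + 1) / q then expMono ξ η d (k + 1) (i / q)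
    else C ((((i + k + 1) / q : ℕ) : ℂ) - ((i / q : ℕ) : ℂ))⁻¹ *
      (dividedDiff ξ η q d k (i + 1) - dividedDiff ξ η q d k i)

lemma dividedDiff_of_eq (ξ η : ℂ) {q d k i : ℕ} (h : i / q = (i + k) / q) :
    dividedDiff ξ η q d k i = expMono ξ η d k (i / q) := by
  cases k with
  | zero => rfl
  | succ k => rw [dividedDiff, if_pos (by rw [h, add_assoc])]

lemma dividedDiff_of_ne (ξ η : ℂ) {q d k i : ℕ} (h : ¬ i / q = (i + k + 1) / q) :
    dividedDiff ξ η q d (k + 1) i = C ((((i + k + 1) / q : ℕ) : ℂ) - ((i / q : ℕ) : ℂ))⁻¹ *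
      (dividedDiff ξ η q d k (i + 1) - dividedDiff ξ η q d k i) := by
  rw [dividedDiff, if_neg h]

lemma isHomogeneous_dividedDiff (ξ η : ℂ) {q d T : ℕ} (hq : 0 < q)
    (hd : q - 1 + (T - 1) / q ≤ d) (k i : ℕ) (hi : i + k < T) :
    (dividedDiff ξ η q d k i).IsHomogeneous d := by
  induction k generalizing i with
  | zero =>
    have := Nat.div_le_div_right (c := q) (show i ≤ T - 1 by omega)
    exact isHomogeneous_expMono ξ η (by omega)
  | succ k ih =>
    rw [dividedDiff]
    split_ifs with h
    · have h1 := Nat.div_le_div_right (c := q) (show i ≤ T - 1 by omega)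
      have h2 : k + 1 < q := by
        by_contra! hk
        have := Nat.div_le_div_right (c := q) (show i + q ≤ i + k + 1 by omega)
        rw [Nat.add_div_right _ hq] at this
        omega
      exact isHomogeneous_expMono ξ η (by omega)
    · simpa using (isHomogeneous_C (Fin 3) _).mul ((ih (i + 1) (by omega)).sub (ih i (by omega)))

lemma endDD_dividedDiff_zero (ξ η : ℂ) (q d i : ℕ) :
    endDD (dividedDiff ξ η q d 0 i) = C ((i / q : ℕ) : ℂ) * dividedDiff ξ η q d 0 i :=
  endDD_expMono_zero ξ η d _

lemma endDD_dividedDiff_succ (ξ η : ℂ) {q d T : ℕ} (hq : 0 < q)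
    (hd : q - 1 + (T - 1) / q ≤ d) (k i : ℕ) (hi : i + k + 1 < T) :
    endDD (dividedDiff ξ η q d (k + 1) i) =
        C ((i / q : ℕ) : ℂ) * dividedDiff ξ η q d (k + 1) i + dividedDiff ξ η q d k (i + 1) ∧
    endDD (dividedDiff ξ η q d (k + 1) i) =
        C (((i + k + 1) / q : ℕ) : ℂ) * dividedDiff ξ η q d (k + 1) i +
          dividedDiff ξ η q d k i := by
  induction k generalizing i with
  | zero =>
    by_cases h : i / q = (i + 0 + 1) / q
    · have h1 := Nat.div_le_div_right (c := q) (show i ≤ T - 1 by omega)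
      have h2 : 0 + 1 < q := by
        by_contra! hk
        have := Nat.div_le_div_right (c := q) (show i + q ≤ i + 0 + 1 by omega)
        rw [Nat.add_div_right _ hq] at this
        omega
      rw [dividedDiff_of_eq (k := 0 + 1) ξ η h, ← h, dividedDiff, dividedDiff]
      rw [endDD_expMono_succ ξ η (by omega)]
      simp only [add_zero] at h
      simp [h]
    · have hne : (((i + 0 + 1) / q : ℕ) : ℂ) - ((i / q : ℕ) : ℂ) ≠ 0 := by
        rw [sub_ne_zero]; exact fun h' => h (by exact_mod_cast h'.symm)
      rw [dividedDiff_of_ne ξ η h]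
      have hC : C ((((i + 0 + 1) / q : ℕ) : ℂ) - ((i / q : ℕ) : ℂ))⁻¹ *
        (C (((i + 0 + 1) / q : ℕ) : ℂ) - C ((i / q : ℕ) : ℂ) : MvPolynomial (Fin 3) ℂ) = 1 := by
        rw [← C_sub, ← C_mul, inv_mul_cancel₀ hne, C_1]
      rw [endDD_mul, endDD_C, map_sub, endDD_dividedDiff_zero, endDD_dividedDiff_zero]
      simp only [add_zero] at hC ⊢
      constructor
      · linear_combination dividedDiff ξ η q d 0 (i + 1) * hC
      · linear_combination dividedDiff ξ η q d 0 i * hC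
  | succ k ih =>
    by_cases h : i / q = (i + (k + 1) + 1) / q
    · have h1 := Nat.div_le_div_right (c := q) (show i ≤ T - 1 by omega)
      have h2 : k + 1 + 1 < q := by
        by_contra! hk
        have := Nat.div_le_div_right (c := q) (show i + q ≤ i + (k + 1) + 1 by omega)
        rw [Nat.add_div_right _ hq] at this
        omega
      have h3 := Nat.div_le_div_right (c := q) (show i ≤ i + 1 by omega)
      have h4 := Nat.div_le_div_right (c := q) (show i + 1 ≤ i + (k + 1) by omega)
      have h5 := Nat.div_le_div_right (c := q) (show i + (k + 1) ≤ i + (k + 1) + 1 by omega)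
      have h6 : i + 1 + (k + 1) = i + (k + 1) + 1 := by omega
      rw [dividedDiff_of_eq (k := k + 1 + 1) ξ η h, ← h,
        dividedDiff_of_eq (k := k + 1) (i := i) ξ η (by omega),
        dividedDiff_of_eq (k := k + 1) (i := i + 1) ξ η (by rw [h6]; omega),
        endDD_expMono_succ ξ η (by omega)]
      have : (i + 1) / q = i / q := by omega
      simp [this]
    · have hne : (((i + (k + 1) + 1) / q : ℕ) : ℂ) - ((i / q : ℕ) : ℂ) ≠ 0 := by
        rw [sub_ne_zero]; exact fun h' => h (by exact_mod_cast h'.symm)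
      rw [dividedDiff_of_ne ξ η h]
      have hC : C ((((i + (k + 1) + 1) / q : ℕ) : ℂ) - ((i / q : ℕ) : ℂ))⁻¹ *
        (C (((i + (k + 1) + 1) / q : ℕ) : ℂ) - C ((i / q : ℕ) : ℂ) : MvPolynomial (Fin 3) ℂ) =
          1 := by
        rw [← C_sub, ← C_mul, inv_mul_cancel₀ hne, C_1]
      obtain ⟨-, ha⟩ := ih (i + 1) (by omega)
      obtain ⟨hb, -⟩ := ih i (by omega)
      have h6 : i + 1 + k + 1 = i + (k + 1) + 1 := by omega
      rw [h6] at ha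
      rw [endDD_mul, endDD_C, map_sub, ha, hb]
      constructor
      · linear_combination dividedDiff ξ η q d (k + 1) (i + 1) * hC
      · linear_combination dividedDiff ξ η q d (k + 1) i * hC

lemma eval_dividedDiff (ξ : ℂ) {η : ℂ} (hη : η ≠ 0) (q d k i : ℕ) :
    eval ![1, ξ, η] (dividedDiff ξ η q d k i) = if k = 0 then 1 else 0 := by
  induction k generalizing i with
  | zero => simp [dividedDiff, expMono, linV, hη]
  | succ k ih =>
    rw [dividedDiff, if_neg k.succ_ne_zero]
    split_ifs with h
    · simp [expMono, linU]
    · simp [ih]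

/-- The Newton polynomial `∏_{r<k} (s - ⌊r/q⌋)`. -/
noncomputable def newtonPoly (q k : ℕ) : Polynomial ℂ :=
  ∏ r ∈ Finset.range k, (Polynomial.X - Polynomial.C ((r / q : ℕ) : ℂ))

lemma natDegree_newtonPoly (q k : ℕ) : (newtonPoly q k).natDegree = k := by
  rw [newtonPoly, Polynomial.natDegree_finsetProd_X_sub_C_eq_card]; simp

lemma aeval_newtonPoly_dividedDiff (ξ η : ℂ) {q d T : ℕ} (hq : 0 < q)
    (hd : q - 1 + (T - 1) / q ≤ d) (l k : ℕ) (hl : l < T) :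
    Polynomial.aeval endDD (newtonPoly q k) (dividedDiff ξ η q d l 0) =
      if k ≤ l then dividedDiff ξ η q d (l - k) k else 0 := by
  induction k with
  | zero => simp [newtonPoly]
  | succ k ih =>
    rw [newtonPoly, Finset.prod_range_succ, mul_comm, map_mul, Module.End.mul_apply]
    rw [newtonPoly] at ih
    rw [ih]
    split_ifs with h1 h2
    · obtain ⟨m, rfl⟩ := Nat.exists_eq_add_of_le h2
      have e1 : k + 1 + m - k = m + 1 := by omega
      have e2 : k + 1 + m - (k + 1) = m := by omega
      rw [e1, e2]
      have := (endDD_dividedDiff_succ ξ η hq hd m k (by omega)).1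
      simp [this]
    · have e1 : l - k = 0 := by omega
      rw [e1]
      simp [endDD_dividedDiff_zero]
    · omega
    · simp

lemma sum_coeff_newtonPoly_jet (ξ : ℂ) {η : ℂ} (hη : η ≠ 0) {q d T : ℕ} (hq : 0 < q)
    (hd : q - 1 + (T - 1) / q ≤ d) (k l : ℕ) (hk : k < T) (hl : l < T) :
    ∑ j ∈ Finset.range T, (newtonPoly q k).coeff j * jet ξ η j (dividedDiff ξ η q d l 0) =
      if k = l then 1 else 0 := by
  have h := congrArg (eval ![1, ξ, η]) (aeval_newtonPoly_dividedDiff ξ η hq hd l k hl)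
  rw [Polynomial.aeval_eq_sum_range' (n := T) (by rwa [natDegree_newtonPoly]),
    LinearMap.sum_apply, map_sum] at h
  simp only [LinearMap.smul_apply, smul_eval, ← jet_apply] at h
  rw [h, apply_ite (eval ![1, ξ, η]), eval_dividedDiff ξ hη]
  split_ifs <;> first | omega | simp

/-- The polynomial of degree `d` whose restriction to the curve is `t ^ i / i!` modulo `t ^ T`. -/
noncomputable def dualPoly (ξ η : ℂ) (q d T i : ℕ) : MvPolynomial (Fin 3) ℂ :=
  ∑ k ∈ Finset.range T, C ((newtonPoly q k).coeff i) * dividedDiff ξ η q d k 0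

lemma isHomogeneous_dualPoly (ξ η : ℂ) {q d T : ℕ} (hq : 0 < q)
    (hd : q - 1 + (T - 1) / q ≤ d) (i : ℕ) : (dualPoly ξ η q d T i).IsHomogeneous d := by
  refine IsHomogeneous.sum _ _ _ fun k hk => ?_
  simpa using (isHomogeneous_C (Fin 3) _).mul
    (isHomogeneous_dividedDiff ξ η hq hd k 0 (by simpa using hk))

lemma jet_dualPoly (ξ : ℂ) {η : ℂ} (hη : η ≠ 0) {q d T : ℕ} (hq : 0 < q)
    (hd : q - 1 + (T - 1) / q ≤ d) (i j : ℕ) (hi : i < T) (hj : j < T) :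
    jet ξ η j (dualPoly ξ η q d T i) = if j = i then 1 else 0 := by
  let M : Matrix (Fin T) (Fin T) ℂ := fun k j => (newtonPoly q k).coeff j
  let N : Matrix (Fin T) (Fin T) ℂ := fun j l => jet ξ η j (dividedDiff ξ η q d l 0)
  have hMN : M * N = 1 := by
    ext k l
    rw [Matrix.mul_apply, Matrix.one_apply]
    have := sum_coeff_newtonPoly_jet ξ hη hq hd k l k.2 l.2
    rw [Finset.sum_range] at this
    simpa [Fin.ext_iff] using this
  have hNM : N * M = 1 := mul_eq_one_comm.mp hMN
  have := congrFun (congrFun hNM ⟨j, hj⟩) ⟨i, hi⟩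
  rw [Matrix.mul_apply, Matrix.one_apply] at this
  simp only [Fin.mk.injEq] at this
  rw [← this, dualPoly, map_sum, Finset.sum_range]
  refine Finset.sum_congr rfl fun k _ => ?_
  rw [← smul_eq_C_mul, map_smul, smul_eq_mul, mul_comm]

lemma plen_nonneg (P : MvPolynomial (Fin 3) ℂ) : 0 ≤ plen P :=
  Finset.sum_nonneg fun _ _ => norm_nonneg _

lemma plen_eq_sum_of_subset {P : MvPolynomial (Fin 3) ℂ} {s : Finset (Fin 3 →₀ ℕ)}
    (h : P.support ⊆ s) : plen P = ∑ v ∈ s, ‖P.coeff v‖ :=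
  Finset.sum_subset h fun v _ hv => by simpa using hv

lemma plen_add_le (P Q : MvPolynomial (Fin 3) ℂ) : plen (P + Q) ≤ plen P + plen Q := by
  classical
  rw [plen_eq_sum_of_subset (support_add (p := P) (q := Q)),
    plen_eq_sum_of_subset (P := P) (Finset.subset_union_left (s₂ := Q.support)),
    plen_eq_sum_of_subset (P := Q) (Finset.subset_union_right (s₁ := P.support)),
    ← Finset.sum_add_distrib]
  exact Finset.sum_le_sum fun v _ => by simpa using norm_add_le _ _

lemma plen_zero : plen 0 = 0 := by simp [plen]

lemma plen_neg (P : MvPolynomial (Fin 3) ℂ) : plen (-P) = plen P := by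
  simp [plen, support_neg]

lemma plen_sub_le (P Q : MvPolynomial (Fin 3) ℂ) : plen (P - Q) ≤ plen P + plen Q := by
  rw [sub_eq_add_neg, ← plen_neg Q]
  exact plen_add_le _ _

lemma plen_sum_le {ι : Type*} (s : Finset ι) (f : ι → MvPolynomial (Fin 3) ℂ) :
    plen (∑ i ∈ s, f i) ≤ ∑ i ∈ s, plen (f i) := by
  classical
  induction s using Finset.induction_on with
  | empty => simp [plen_zero]
  | insert a s ha ih =>
    rw [Finset.sum_insert ha, Finset.sum_insert ha]
    exact (plen_add_le _ _).trans (by gcongr)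

lemma plen_monomial (v : Fin 3 →₀ ℕ) (a : ℂ) : plen (monomial v a) = ‖a‖ := by
  classical
  rw [plen_eq_sum_of_subset support_monomial_subset]
  simp

lemma plen_mul_le (P Q : MvPolynomial (Fin 3) ℂ) : plen (P * Q) ≤ plen P * plen Q := by
  have h : P * Q = ∑ v ∈ P.support, ∑ w ∈ Q.support,
      monomial (v + w) (P.coeff v * Q.coeff w) := by
    conv_lhs => rw [P.as_sum, Q.as_sum, Finset.sum_mul_sum]
    simp only [monomial_mul]
  rw [h]
  refine (plen_sum_le _ _).trans ?_
  rw [plen, plen, Finset.sum_mul_sum]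
  refine Finset.sum_le_sum fun v _ => (plen_sum_le _ _).trans (Finset.sum_le_sum fun w _ => ?_)
  rw [plen_monomial, norm_mul]

lemma plen_C (a : ℂ) : plen (C a) = ‖a‖ := plen_monomial 0 a

lemma plen_X (i : Fin 3) : plen (X i) = 1 :=
  (plen_monomial _ _).trans norm_one

lemma plen_C_mul_le (a : ℂ) (P : MvPolynomial (Fin 3) ℂ) : plen (C a * P) ≤ ‖a‖ * plen P :=
  (plen_mul_le _ _).trans_eq (by rw [plen_C])

lemma plen_X_mul_le (i : Fin 3) (P : MvPolynomial (Fin 3) ℂ) : plen (X i * P) ≤ plen P :=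
  (plen_mul_le _ _).trans_eq (by rw [plen_X, one_mul])

lemma plen_pow_le (P : MvPolynomial (Fin 3) ℂ) (n : ℕ) : plen (P ^ n) ≤ plen P ^ n := by
  induction n with
  | zero => simpa using (plen_C 1).le
  | succ n ih =>
    rw [pow_succ, pow_succ]
    exact (plen_mul_le _ _).trans (mul_le_mul_of_nonneg_right ih (plen_nonneg _))

lemma plen_linU_le (ξ : ℂ) : plen (linU ξ) ≤ 1 + ‖ξ‖ := by
  refine (plen_sub_le _ _).trans ?_
  have := plen_C_mul_le ξ (X 0)
  rw [plen_X] at this ⊢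
  linarith

lemma plen_linV_le (η : ℂ) : plen (linV η) ≤ ‖η‖⁻¹ := by
  have := plen_C_mul_le η⁻¹ (X 2)
  rwa [plen_X, mul_one, norm_inv] at this

lemma plen_expMono_le {ξ η : ℂ} {c : ℝ} (hc1 : 1 ≤ c) (hcU : plen (linU ξ) ≤ c)
    (hcV : plen (linV η) ≤ c) {d k a : ℕ} (h : k + a ≤ d) :
    plen (expMono ξ η d k a) ≤ c ^ d := by
  have hfac : ‖(k.factorial : ℂ)⁻¹‖ ≤ 1 := by
    rw [norm_inv, Complex.norm_natCast]
    exact inv_le_one_of_one_le₀ (by exact_mod_cast k.factorial_pos)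
  have h1 : plen (linU ξ ^ k) ≤ c ^ k :=
    (plen_pow_le _ _).trans (pow_le_pow_left₀ (plen_nonneg _) hcU _)
  have h2 : plen (linV η ^ a) ≤ c ^ a :=
    (plen_pow_le _ _).trans (pow_le_pow_left₀ (plen_nonneg _) hcV _)
  have h3 : plen (X 0 ^ (d - k - a)) ≤ 1 := (plen_pow_le _ _).trans (by simp [plen_X])
  have h4 := plen_nonneg (linU ξ ^ k)
  have h5 := plen_nonneg (linV η ^ a)
  calc plen (expMono ξ η d k a)
      ≤ ‖(k.factorial : ℂ)⁻¹‖ * plen (linU ξ ^ k * linV η ^ a * X 0 ^ (d - k - a)) :=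
        plen_C_mul_le _ _
    _ ≤ 1 * (c ^ k * c ^ a * 1) := by
        refine mul_le_mul hfac ?_ (plen_nonneg _) zero_le_one
        refine (plen_mul_le _ _).trans (mul_le_mul ?_ h3 (plen_nonneg _) (by positivity))
        exact (plen_mul_le _ _).trans (mul_le_mul h1 h2 h5 (by positivity))
    _ = c ^ (k + a) := by ring
    _ ≤ c ^ d := pow_le_pow_right₀ hc1 h

lemma plen_dividedDiff_le {ξ η : ℂ} {c : ℝ} (hc1 : 1 ≤ c) (hcU : plen (linU ξ) ≤ c)
    (hcV : plen (linV η) ≤ c) {q d T : ℕ} (hq : 0 < q)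
    (hd : q - 1 + (T - 1) / q ≤ d) (k i : ℕ) (hi : i + k < T) :
    plen (dividedDiff ξ η q d k i) ≤ 2 ^ k * c ^ d := by
  induction k generalizing i with
  | zero =>
    have := Nat.div_le_div_right (c := q) (show i ≤ T - 1 by omega)
    simpa [dividedDiff] using plen_expMono_le hc1 hcU hcV (show 0 + i / q ≤ d by omega)
  | succ k ih =>
    by_cases h : i / q = (i + k + 1) / q
    · have h1 := Nat.div_le_div_right (c := q) (show i ≤ T - 1 by omega)
      have h2 : k + 1 < q := by
        by_contra! hk
        have := Nat.div_le_div_right (c := q) (show i + q ≤ i + k + 1 by omega)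
        rw [Nat.add_div_right _ hq] at this
        omega
      rw [dividedDiff_of_eq (k := k + 1) ξ η h]
      refine (plen_expMono_le hc1 hcU hcV (by omega)).trans ?_
      exact le_mul_of_one_le_left (by positivity) (one_le_pow₀ one_le_two)
    · rw [dividedDiff_of_ne ξ η h]
      have hn : ‖((((i + k + 1) / q : ℕ) : ℂ) - ((i / q : ℕ) : ℂ))⁻¹‖ ≤ 1 := by
        have hlt : i / q + 1 ≤ (i + k + 1) / q := by
          have := Nat.div_le_div_right (c := q) (show i ≤ i + k + 1 by omega)
          omega
        rw [norm_inv, ← Nat.cast_sub (by omega), Complex.norm_natCast]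
        exact inv_le_one_of_one_le₀ (by exact_mod_cast (by omega))
      calc _ ≤ ‖((((i + k + 1) / q : ℕ) : ℂ) - ((i / q : ℕ) : ℂ))⁻¹‖ *
              plen (dividedDiff ξ η q d k (i + 1) - dividedDiff ξ η q d k i) := plen_C_mul_le _ _
        _ ≤ 1 * (2 ^ k * c ^ d + 2 ^ k * c ^ d) := by
            refine mul_le_mul hn ?_ (plen_nonneg _) zero_le_one
            exact (plen_sub_le _ _).trans (add_le_add (ih (i + 1) (by omega)) (ih i (by omega)))
        _ = 2 ^ (k + 1) * c ^ d := by ring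

lemma norm_coeff_newtonPoly_le {q T : ℕ} (k i : ℕ) (hk : k ≤ T) :
    ‖(newtonPoly q k).coeff i‖ ≤ (T : ℝ) ^ k := by
  induction k generalizing i with
  | zero =>
    simp only [newtonPoly, Finset.range_zero, Finset.prod_empty, pow_zero, Polynomial.coeff_one]
    split_ifs <;> simp
  | succ k ih =>
    have hkT : ((k / q : ℕ) : ℝ) + 1 ≤ T := by
      have := Nat.div_le_self k q
      exact_mod_cast (by omega)
    have h1 : ‖(newtonPoly q k).coeff i * ((k / q : ℕ) : ℂ)‖ ≤ (T : ℝ) ^ k * ((k / q : ℕ) : ℝ) := by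
      rw [norm_mul, Complex.norm_natCast]
      exact mul_le_mul_of_nonneg_right (ih i (by omega)) (Nat.cast_nonneg _)
    have h2 : ‖(newtonPoly q k * Polynomial.X).coeff i‖ ≤ (T : ℝ) ^ k := by
      cases i with
      | zero => simp
      | succ i => rw [Polynomial.coeff_mul_X]; exact ih i (by omega)
    have h3 : newtonPoly q (k + 1) =
        newtonPoly q k * (Polynomial.X - Polynomial.C ((k / q : ℕ) : ℂ)) :=
      Finset.prod_range_succ _ _
    rw [h3, mul_sub, Polynomial.coeff_sub, Polynomial.coeff_mul_C]
    calc _ ≤ (T : ℝ) ^ k + (T : ℝ) ^ k * ((k / q : ℕ) : ℝ) :=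
          (norm_sub_le _ _).trans (add_le_add h2 h1)
      _ = (T : ℝ) ^ k * (((k / q : ℕ) : ℝ) + 1) := by ring
      _ ≤ (T : ℝ) ^ (k + 1) := by rw [pow_succ]; gcongr

lemma plen_dualPoly_le {ξ η : ℂ} {c : ℝ} (hc1 : 1 ≤ c) (hcU : plen (linU ξ) ≤ c)
    (hcV : plen (linV η) ≤ c) {q d T : ℕ} (hq : 0 < q)
    (hd : q - 1 + (T - 1) / q ≤ d) (i : ℕ) :
    plen (dualPoly ξ η q d T i) ≤ T * (T ^ T * (2 ^ T * c ^ d)) := by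
  refine (plen_sum_le _ _).trans ?_
  have : ∀ k ∈ Finset.range T,
      plen (C ((newtonPoly q k).coeff i) * dividedDiff ξ η q d k 0) ≤
        (T : ℝ) ^ T * (2 ^ T * c ^ d) := fun k hk => by
    rw [Finset.mem_range] at hk
    have hT : (1 : ℝ) ≤ T := by exact_mod_cast (by omega)
    have h1 := plen_dividedDiff_le hc1 hcU hcV hq hd k 0 (by omega)
    refine (plen_C_mul_le _ _).trans (mul_le_mul ?_ (h1.trans ?_) (plen_nonneg _) (by positivity))
    · exact (norm_coeff_newtonPoly_le k i hk.le).trans (pow_le_pow_right₀ hT hk.le)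
    · gcongr
      · norm_num
  simpa using Finset.sum_le_sum this

lemma norm_eval_le_plen {α : Fin 3 → ℂ} (hα : ∀ i, ‖α i‖ ≤ 1) (P : MvPolynomial (Fin 3) ℂ) :
    ‖eval α P‖ ≤ plen P := by
  rw [eval_eq', plen]
  refine (norm_sum_le _ _).trans (Finset.sum_le_sum fun v _ => ?_)
  rw [norm_mul, norm_prod]
  refine mul_le_of_le_one_right (norm_nonneg _)
    (Finset.prod_le_one (fun _ _ => norm_nonneg _) fun i _ => ?_)
  rw [norm_pow]
  exact pow_le_one₀ (norm_nonneg _) (hα i)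

lemma norm_coeff_le_pnorm (P : MvPolynomial (Fin 3) ℂ) (v : Fin 3 →₀ ℕ) :
    ‖P.coeff v‖ ≤ pnorm P := by
  by_cases hv : v ∈ P.support
  · exact NNReal.coe_le_coe.mpr (Finset.le_sup (f := fun v => ‖P.coeff v‖₊) hv)
  · rw [notMem_support_iff.mp hv, norm_zero]
    exact NNReal.coe_nonneg _

lemma pnorm_le_plen (P : MvPolynomial (Fin 3) ℂ) : pnorm P ≤ plen P := by
  have : (P.support.sup fun v => ‖P.coeff v‖₊) ≤ (⟨plen P, plen_nonneg P⟩ : NNReal) :=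
    Finset.sup_le fun v hv => NNReal.coe_le_coe.mp
      (Finset.single_le_sum (f := fun v => ‖P.coeff v‖) (fun _ _ => norm_nonneg _) hv)
  exact this

lemma plen_le_card_mul_pnorm {P : MvPolynomial (Fin 3) ℂ} {D : ℕ} (hP : P.IsHomogeneous D) :
    plen P ≤ ((Finset.univ : Finset (Fin 3)).finsuppAntidiag D).card * pnorm P := by
  classical
  have hs : P.support ⊆ (Finset.univ : Finset (Fin 3)).finsuppAntidiag D := fun v hv => by
    have := hP (mem_support_iff.mp hv)
    rw [Finset.mem_finsuppAntidiag]
    refine ⟨?_, Finset.subset_univ _⟩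
    rw [← this, Finsupp.weight_apply, Finsupp.sum_fintype _ _ (by simp)]
    simp
  rw [plen_eq_sum_of_subset hs]
  simpa using Finset.sum_le_sum fun v (_ : v ∈ Finset.univ.finsuppAntidiag D) =>
    norm_coeff_le_pnorm P v

lemma bddAbove_Isup (ξ η : ℂ) (T D : ℕ) {α : Fin 3 → ℂ} (hα : ∀ i, ‖α i‖ ≤ 1) :
    BddAbove {x : ℝ | ∃ P : MvPolynomial (Fin 3) ℂ,
      P ∈ Igam ξ η T ∧ P.IsHomogeneous D ∧ pnorm P ≤ 1 ∧ x = ‖eval α P‖} := by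
  refine ⟨((Finset.univ : Finset (Fin 3)).finsuppAntidiag D).card, ?_⟩
  rintro _ ⟨P, -, hP, h1, rfl⟩
  refine (norm_eval_le_plen hα P).trans ((plen_le_card_mul_pnorm hP).trans ?_)
  exact mul_le_of_le_one_right (Nat.cast_nonneg _) h1

lemma norm_eval_le_mul_Isup {ξ η : ℂ} {T D : ℕ} {α : Fin 3 → ℂ} (hα : ∀ i, ‖α i‖ ≤ 1)
    {P : MvPolynomial (Fin 3) ℂ} (hP : P ∈ Igam ξ η T) (hD : P.IsHomogeneous D) {B : ℝ}
    (hB : 0 < B) (hPB : plen P ≤ B) : ‖eval α P‖ ≤ B * Isup ξ η T D α := by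
  have hnorm : ‖(B : ℂ)⁻¹‖ = B⁻¹ := by
    rw [norm_inv, Complex.norm_real, Real.norm_of_nonneg hB.le]
  have h := le_csSup (bddAbove_Isup ξ η T D hα)
    ⟨C (B : ℂ)⁻¹ * P, Ideal.mul_mem_left _ _ hP,
      by simpa using (isHomogeneous_C (Fin 3) (B : ℂ)⁻¹).mul hD, ?_, rfl⟩
  · rw [map_mul, eval_C, norm_mul, hnorm] at h
    rwa [inv_mul_le_iff₀ hB] at h
  · refine (pnorm_le_plen _).trans ((plen_C_mul_le _ _).trans ?_)
    rw [hnorm, inv_mul_le_iff₀ hB, mul_one]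
    exact hPB

lemma norm_sub_exp_le {z v : ℂ} {f : ℕ → ℂ} {ε C : ℝ} {T : ℕ} (hT : 1 ≤ T) (hC : 1 ≤ C)
    (hε : 0 ≤ ε) (hz : ‖z‖ ≤ C) (h0 : ‖1 - f 0‖ ≤ ε)
    (hstep : ∀ i, i + 1 < T → ‖z * f i - (i + 1) * f (i + 1)‖ ≤ ε)
    (hlast : ‖z * f (T - 1)‖ ≤ ε) (hsum : ‖v - ∑ i ∈ Finset.range T, f i‖ ≤ ε) :
    ‖v - Complex.exp z‖ ≤ ε * (1 + C) ^ T * Real.exp C * (3 * T ^ T) := by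
  have hr : ∀ i < T, ‖f i - z ^ i / i.factorial‖ ≤ ε * (1 + C) ^ i := fun i => by
    induction i with
    | zero => intro _; simpa [norm_sub_rev] using h0
    | succ i ih =>
      intro hi
      have h1 := ih (by omega)
      have h2 := hstep i hi
      have hi0 : ((i : ℂ) + 1) ≠ 0 := by exact_mod_cast i.succ_ne_zero
      have hfac : (i.factorial : ℂ) ≠ 0 := by exact_mod_cast i.factorial_ne_zero
      have e : ((i : ℂ) + 1) * (f (i + 1) - z ^ (i + 1) / (i + 1).factorial) =
          z * (f i - z ^ i / i.factorial) - (z * f i - (i + 1) * f (i + 1)) := by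
        rw [Nat.factorial_succ]
        push_cast
        field_simp
        ring
      have hn : ‖((i : ℂ) + 1)‖ = i + 1 := by
        rw [← Nat.cast_add_one, Complex.norm_natCast, Nat.cast_add_one]
      have h3 : ((i : ℝ) + 1) * ‖f (i + 1) - z ^ (i + 1) / (i + 1).factorial‖ ≤
          C * (ε * (1 + C) ^ i) + ε := by
        rw [← hn, ← norm_mul, e]
        refine (norm_sub_le _ _).trans (add_le_add ?_ h2)
        rw [norm_mul]
        exact mul_le_mul hz h1 (norm_nonneg _) (by linarith)
      have h4 : ‖f (i + 1) - z ^ (i + 1) / (i + 1).factorial‖ ≤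
          ((i : ℝ) + 1) * ‖f (i + 1) - z ^ (i + 1) / (i + 1).factorial‖ :=
        le_mul_of_one_le_left (norm_nonneg _) (by simp)
      have h5 : ε ≤ ε * (1 + C) ^ i :=
        le_mul_of_one_le_right hε (one_le_pow₀ (by linarith))
      rw [pow_succ (1 + C)]
      linarith
  have hpow : ‖z‖ ^ T ≤ T ^ T * (ε * (1 + C) ^ T) := by
    obtain ⟨n, rfl⟩ := Nat.exists_eq_add_of_le' hT
    have hfac : (n.factorial : ℂ) ≠ 0 := by exact_mod_cast n.factorial_ne_zero
    have e : z ^ (n + 1) = n.factorial * (z * f n - z * (f n - z ^ n / n.factorial)) := by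
      field_simp
      ring
    have h1 := hr n (by omega)
    have h2 : (n.factorial : ℝ) ≤ ((n + 1 : ℕ) : ℝ) ^ (n + 1) := by
      exact_mod_cast (Nat.factorial_le n.le_succ).trans (Nat.factorial_le_pow (n + 1))
    rw [← norm_pow, e, norm_mul, Complex.norm_natCast]
    refine mul_le_mul h2 ?_ (norm_nonneg _) (by positivity)
    have h3 : ‖z * (f n - z ^ n / n.factorial)‖ ≤ C * (ε * (1 + C) ^ n) := by
      rw [norm_mul]
      exact mul_le_mul hz h1 (norm_nonneg _) (by linarith)
    have h5 : ε ≤ ε * (1 + C) ^ n :=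
      le_mul_of_one_le_right hε (one_le_pow₀ (by linarith))
    have h6 := norm_sub_le (z * f n) (z * (f n - z ^ n / n.factorial))
    simp only [Nat.add_sub_cancel] at hlast
    rw [pow_succ]
    linarith
  have hT' : (1 : ℝ) ≤ T := by exact_mod_cast hT
  have hTT : (T : ℝ) ≤ T ^ T := le_self_pow₀ hT' (by omega)
  have hexp : 1 ≤ Real.exp C := Real.one_le_exp (by linarith)
  set A := ε * (1 + C) ^ T with hA
  have hA0 : 0 ≤ A := by positivity
  have hεA : ε ≤ A := le_mul_of_one_le_right hε (one_le_pow₀ (by linarith))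
  have s1 : ‖∑ i ∈ Finset.range T, (f i - z ^ i / i.factorial)‖ ≤ T * A := by
    refine (norm_sum_le _ _).trans ?_
    have : ∀ i ∈ Finset.range T, ‖f i - z ^ i / i.factorial‖ ≤ A := fun i hi => by
      rw [Finset.mem_range] at hi
      refine (hr i hi).trans ?_
      rw [hA]
      gcongr
      · linarith
    simpa using Finset.sum_le_sum this
  have s2 : ‖Complex.exp z - ∑ i ∈ Finset.range T, z ^ i / i.factorial‖ ≤
      T ^ T * A * Real.exp C := by
    refine (Complex.norm_exp_sub_sum_le_norm_mul_exp z T).trans ?_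
    exact mul_le_mul hpow (Real.exp_le_exp.mpr hz) (Real.exp_pos _).le (by positivity)
  have e : v - Complex.exp z = (v - ∑ i ∈ Finset.range T, f i) +
      ∑ i ∈ Finset.range T, (f i - z ^ i / i.factorial) -
      (Complex.exp z - ∑ i ∈ Finset.range T, z ^ i / i.factorial) := by
    rw [Finset.sum_sub_distrib]
    ring
  rw [e]
  have t1 : A ≤ T ^ T * A * Real.exp C := by
    calc A = 1 * A * 1 := by ring
      _ ≤ T ^ T * A * Real.exp C := by gcongr; exact one_le_pow₀ hT'
  have t2 : T * A ≤ T ^ T * A * Real.exp C := by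
    calc T * A = T * A * 1 := by ring
      _ ≤ T ^ T * A * Real.exp C := by gcongr
  have t3 := norm_sub_le ((v - ∑ i ∈ Finset.range T, f i) +
      ∑ i ∈ Finset.range T, (f i - z ^ i / i.factorial))
      (Complex.exp z - ∑ i ∈ Finset.range T, z ^ i / i.factorial)
  have t4 := norm_add_le (v - ∑ i ∈ Finset.range T, f i)
      (∑ i ∈ Finset.range T, (f i - z ^ i / i.factorial))
  linarith

lemma sub_X0_mul_dualPoly_zero_mem (ξ : ℂ) {η : ℂ} (hη : η ≠ 0) {q d T : ℕ} (hq : 0 < q)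
    (hd : q - 1 + (T - 1) / q ≤ d) (hT : 0 < T) :
    X 0 ^ (d + 1) - X 0 * dualPoly ξ η q d T 0 ∈ Igam ξ η T ∧
      (X 0 ^ (d + 1) - X 0 * dualPoly ξ η q d T 0).IsHomogeneous (d + 1) := by
  have hh : (X 0 ^ (d + 1) - X 0 * dualPoly ξ η q d T 0).IsHomogeneous (d + 1) := by
    refine IsHomogeneous.sub (isHomogeneous_X_pow _ _) ?_
    rw [add_comm d]
    exact (isHomogeneous_X ℂ (0 : Fin 3)).mul (isHomogeneous_dualPoly ξ η hq hd 0)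
  refine ⟨mem_Igam hh fun j hj => ?_, hh⟩
  rw [map_sub, jet_X0_mul, jet_dualPoly ξ hη hq hd 0 j hT hj, ← mul_one (X 0 ^ (d + 1)),
    jet_X0_pow_mul, jet_one, sub_self]

lemma linU_mul_dualPoly_sub_mem (ξ : ℂ) {η : ℂ} (hη : η ≠ 0) {q d T : ℕ} (hq : 0 < q)
    (hd : q - 1 + (T - 1) / q ≤ d) {i : ℕ} (hi : i + 1 < T) :
    linU ξ * dualPoly ξ η q d T i - C ((i : ℂ) + 1) * (X 0 * dualPoly ξ η q d T (i + 1)) ∈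
        Igam ξ η T ∧
      (linU ξ * dualPoly ξ η q d T i -
        C ((i : ℂ) + 1) * (X 0 * dualPoly ξ η q d T (i + 1))).IsHomogeneous (d + 1) := by
  have hh : (linU ξ * dualPoly ξ η q d T i -
      C ((i : ℂ) + 1) * (X 0 * dualPoly ξ η q d T (i + 1))).IsHomogeneous (d + 1) := by
    rw [add_comm d]
    refine IsHomogeneous.sub ((isHomogeneous_linU ξ).mul (isHomogeneous_dualPoly ξ η hq hd i)) ?_
    simpa using (isHomogeneous_C (Fin 3) ((i : ℂ) + 1)).mul
      ((isHomogeneous_X ℂ (0 : Fin 3)).mul (isHomogeneous_dualPoly ξ η hq hd (i + 1)))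
  refine ⟨mem_Igam hh fun j hj => ?_, hh⟩
  rw [map_sub, ← smul_eq_C_mul, map_smul, jet_X0_mul, jet_dualPoly ξ hη hq hd (i + 1) j hi hj]
  cases j with
  | zero => simp [jet_zero_linU_mul]
  | succ j =>
    rw [jet_succ_linU_mul, jet_dualPoly ξ hη hq hd i j (by omega) (by omega)]
    by_cases h : j = i <;> simp [h]

lemma linU_mul_dualPoly_last_mem (ξ : ℂ) {η : ℂ} (hη : η ≠ 0) {q d T : ℕ} (hq : 0 < q)
    (hd : q - 1 + (T - 1) / q ≤ d) (hT : 0 < T) :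
    linU ξ * dualPoly ξ η q d T (T - 1) ∈ Igam ξ η T ∧
      (linU ξ * dualPoly ξ η q d T (T - 1)).IsHomogeneous (d + 1) := by
  have hh : (linU ξ * dualPoly ξ η q d T (T - 1)).IsHomogeneous (d + 1) := by
    rw [add_comm d]
    exact (isHomogeneous_linU ξ).mul (isHomogeneous_dualPoly ξ η hq hd _)
  refine ⟨mem_Igam hh fun j hj => ?_, hh⟩
  cases j with
  | zero => simp [jet_zero_linU_mul]
  | succ j =>
    rw [jet_succ_linU_mul, jet_dualPoly ξ hη hq hd _ j (by omega) (by omega), if_neg (by omega),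
      mul_zero]

lemma linV_sub_sum_mem (ξ : ℂ) {η : ℂ} (hη : η ≠ 0) {q d T : ℕ} (hq : 0 < q)
    (hd : q - 1 + (T - 1) / q ≤ d) :
    X 0 ^ d * linV η - ∑ i ∈ Finset.range T, X 0 * dualPoly ξ η q d T i ∈ Igam ξ η T ∧
      (X 0 ^ d * linV η -
        ∑ i ∈ Finset.range T, X 0 * dualPoly ξ η q d T i).IsHomogeneous (d + 1) := by
  have hh : (X 0 ^ d * linV η -
      ∑ i ∈ Finset.range T, X 0 * dualPoly ξ η q d T i).IsHomogeneous (d + 1) := by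
    refine IsHomogeneous.sub ((isHomogeneous_X_pow _ _).mul (isHomogeneous_linV η)) ?_
    rw [add_comm d]
    exact IsHomogeneous.sum _ _ _ fun i _ =>
      (isHomogeneous_X ℂ (0 : Fin 3)).mul (isHomogeneous_dualPoly ξ η hq hd i)
  refine ⟨mem_Igam hh fun j hj => ?_, hh⟩
  have : ∀ i ∈ Finset.range T, jet ξ η j (X 0 * dualPoly ξ η q d T i) = if j = i then 1 else 0 :=
    fun i hi => by rw [jet_X0_mul, jet_dualPoly ξ hη hq hd i j (Finset.mem_range.mp hi) hj]
  rw [map_sub, jet_X0_pow_mul, jet_linV ξ hη, map_sum, Finset.sum_congr rfl this]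
  simp [hj]

lemma pow_six_mul_le_rpow {T : ℕ} (hT : 3 ≤ T) :
    (T : ℝ) ^ (6 * T) ≤ (T : ℝ) ^ (6 * (T : ℝ) * Real.log T) := by
  have hT' : (3 : ℝ) ≤ T := by exact_mod_cast hT
  have hlog : 1 ≤ Real.log T := by
    rw [Real.le_log_iff_exp_le (by linarith)]
    linarith [Real.exp_one_lt_d9]
  rw [← Real.rpow_natCast]
  refine Real.rpow_le_rpow_of_exponent_le (by linarith) ?_
  push_cast
  exact le_mul_of_one_le_right (by positivity) hlog

lemma pow_mul_const_le {c C : ℝ} {T d : ℕ} (hc : 2 ≤ c) (hC : 1 ≤ C) (hT : 3 ≤ T)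
    (hd : d + 1 ≤ T) :
    (c + T) * (T * (T ^ T * (2 ^ T * c ^ d))) * (2 * C) ^ (d + 1) *
        ((1 + C) ^ T * T ^ T) ≤
      ((2 * C + 3) * (c * C) ^ 2) ^ T * (T : ℝ) ^ (6 * T) := by
  have hT' : (3 : ℝ) ≤ T := by exact_mod_cast hT
  have hT1 : (1 : ℝ) ≤ T := by linarith
  have h1 : c + T ≤ c * T := by nlinarith
  have h2 : (2 * C) ^ (d + 1) ≤ (2 * C) ^ T := pow_le_pow_right₀ (by linarith) hd
  have h3 : (1 + C) ^ T ≤ (2 * C) ^ T := pow_le_pow_left₀ (by linarith) (by linarith) _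
  have h4 : c * c ^ d ≤ c ^ T := by
    rw [← pow_succ']
    exact pow_le_pow_right₀ (by linarith) hd
  have h5 : (2 : ℝ) ^ T ≤ T ^ T := pow_le_pow_left₀ (by norm_num) (by linarith) _
  have h6 : (T : ℝ) * T ≤ T ^ T := by
    rw [← pow_two]
    exact pow_le_pow_right₀ hT1 (by omega)
  have h7 : (1 : ℝ) ≤ T ^ T := one_le_pow₀ hT1
  calc (c + T) * (T * (T ^ T * (2 ^ T * c ^ d))) * (2 * C) ^ (d + 1) * ((1 + C) ^ T * T ^ T)
      ≤ (c * T) * (T * (T ^ T * (T ^ T * c ^ d))) * (2 * C) ^ T * ((2 * C) ^ T * T ^ T) := by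
        gcongr
    _ = (2 * C) ^ T * (2 * C) ^ T * (c * c ^ d) * (T * T) * (T ^ T * T ^ T * T ^ T) := by ring
    _ ≤ (2 * C) ^ T * (2 * C) ^ T * c ^ T * T ^ T * (T ^ T * T ^ T * T ^ T) * 1 * 1 := by
        rw [mul_one, mul_one]
        gcongr
    _ ≤ (2 * C) ^ T * (2 * C) ^ T * c ^ T * T ^ T * (T ^ T * T ^ T * T ^ T) * T ^ T * T ^ T := by
        gcongr
    _ = (2 * C * (2 * C * c)) ^ T * (T : ℝ) ^ (6 * T) := by
        rw [mul_pow (2 * C) (2 * C * c), mul_pow (2 * C) c, mul_comm 6 T, pow_mul]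
        ring
    _ ≤ ((2 * C + 3) * (c * C) ^ 2) ^ T * (T : ℝ) ^ (6 * T) := by
        have h8 : 2 * C * c ≤ (c * C) ^ 2 := by
          have : 2 ≤ c * C := by nlinarith
          nlinarith
        gcongr
        linarith

set_option maxHeartbeats 800000 in
theorem stmt14 (ξ η : ℂ) (hη : η ≠ 0) (D T : ℕ) (hD : 3 ≤ D) (hDT : D ≤ T)
    (hT2 : T ≤ Nat.choose (D / 3 + 1) 2)
    (α₀ α₁ α₂ : ℂ) (hα : max ‖α₀‖ (max ‖α₁‖ ‖α₂‖) = 1)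
    (hd : pdist ξ η α₀ α₁ α₂ ≤ (2 * c2c ξ η)⁻¹) :
    adist ξ η α₀ α₁ α₂ ≤
      c4c ξ η * c5c ξ η ^ T * (T : ℝ) ^ (6 * (T : ℝ) * Real.log T) *
        Isup ξ η T D ![α₀, α₁, α₂] := by
  obtain ⟨d, rfl⟩ := Nat.exists_eq_add_of_le' (show 1 ≤ D by omega)
  set q := (d + 1) / 3 with hq_def
  have hq : 0 < q := by omega
  have hdq : q - 1 + (T - 1) / q ≤ d := by
    have h1 : (T - 1) / q < q + 1 := by
      rw [Nat.div_lt_iff_lt_mul hq]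
      have h2 : Nat.choose (q + 1) 2 ≤ (q + 1) * q := by
        rw [Nat.choose_two_right]
        exact Nat.div_le_self _ _
      omega
    omega
  unfold adist c4c c5c c3c
  have hC : 1 ≤ c2c ξ η := le_max_left _ _
  have hξC : ‖ξ‖ ≤ c2c ξ η := (le_max_left _ _).trans (le_max_right _ _)
  have hηC : ‖η‖ ≤ c2c ξ η := (le_max_right _ _).trans (le_max_right _ _)
  unfold pdist at hd
  set C' := c2c ξ η
  set c := 2 + ‖ξ‖ + ‖η‖⁻¹ with hc_def
  have hηinv : 0 ≤ ‖η‖⁻¹ := by positivity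
  have hξ0 := norm_nonneg ξ
  have hc : 2 ≤ c := by linarith
  have hcU : plen (linU ξ) ≤ c := (plen_linU_le ξ).trans (by linarith)
  have hcV : plen (linV η) ≤ c := (plen_linV_le η).trans (by linarith)
  rw [mul_inv, mul_comm 2⁻¹, mul_le_mul_iff_of_pos_left (by positivity)] at hd
  have hd1 : ‖α₁ - α₀ * ξ‖ ≤ 2⁻¹ := (le_max_left _ _).trans hd
  have hd2 : ‖α₂ - α₀ * η‖ ≤ 2⁻¹ := ((le_max_left _ _).trans (le_max_right _ _)).trans hd
  have hα0 : ‖α₀‖ ≤ 1 := (le_max_left _ _).trans_eq hα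
  have hα1 : ‖α₁‖ ≤ 1 := ((le_max_left _ _).trans (le_max_right _ _)).trans_eq hα
  have hα2 : ‖α₂‖ ≤ 1 := ((le_max_right _ _).trans (le_max_right _ _)).trans_eq hα
  have hlow : 1 ≤ ‖α₀‖ * (2 * C') := by
    by_contra! hlt
    have b1 : ‖α₁‖ < 1 := by
      have := norm_add_le (α₁ - α₀ * ξ) (α₀ * ξ)
      rw [sub_add_cancel, norm_mul] at this
      have := mul_le_mul_of_nonneg_left hξC (norm_nonneg α₀)
      linarith
    have b2 : ‖α₂‖ < 1 := by
      have := norm_add_le (α₂ - α₀ * η) (α₀ * η)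
      rw [sub_add_cancel, norm_mul] at this
      have := mul_le_mul_of_nonneg_left hηC (norm_nonneg α₀)
      linarith
    have b0 : ‖α₀‖ < 1 := by nlinarith [norm_nonneg α₀]
    exact absurd hα (max_lt b0 (max_lt b1 b2)).ne
  have hα0pos : 0 < ‖α₀‖ := by
    by_contra! h
    have : ‖α₀‖ = 0 := le_antisymm h (norm_nonneg _)
    rw [this, zero_mul] at hlow
    linarith
  have hα0ne : α₀ ≠ 0 := norm_pos_iff.mp hα0pos
  set α : Fin 3 → ℂ := ![α₀, α₁, α₂]
  have hαi : ∀ i, ‖α i‖ ≤ 1 := by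
    intro i
    fin_cases i <;> assumption
  set B : ℝ := T * (T ^ T * (2 ^ T * c ^ d)) with hB_def
  set S := Isup ξ η T (d + 1) α
  have hS : 0 ≤ S := by
    refine Real.sSup_nonneg ?_
    rintro _ ⟨P, -, -, -, rfl⟩
    exact norm_nonneg _
  have hT1 : (3 : ℝ) ≤ T := by exact_mod_cast hD.trans hDT
  have hB1 : 1 ≤ B := by
    have h1 : (1 : ℝ) ≤ T ^ T := one_le_pow₀ (by linarith)
    have h2 : (1 : ℝ) ≤ 2 ^ T := one_le_pow₀ (by norm_num)
    have h3 : 1 ≤ c ^ d := one_le_pow₀ (by linarith)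
    exact one_le_mul_of_one_le_of_one_le (by linarith)
      (one_le_mul_of_one_le_of_one_le h1 (one_le_mul_of_one_le_of_one_le h2 h3))
  have hQ : ∀ i, plen (dualPoly ξ η q d T i) ≤ B :=
    plen_dualPoly_le (by linarith) hcU hcV hq hdq
  have hXQ : ∀ i, plen (X 0 * dualPoly ξ η q d T i) ≤ B :=
    fun i => (plen_X_mul_le _ _).trans (hQ i)
  have hUQ : ∀ i, plen (linU ξ * dualPoly ξ η q d T i) ≤ c * B := fun i =>
    (plen_mul_le _ _).trans (mul_le_mul hcU (hQ i) (plen_nonneg _) (by linarith))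
  set ε := (c + T) * B * S * (2 * C') ^ (d + 1) with hε_def
  have hε : 0 ≤ ε := by positivity
  have key : ∀ P : MvPolynomial (Fin 3) ℂ, (P ∈ Igam ξ η T ∧ P.IsHomogeneous (d + 1)) →
      plen P ≤ (c + T) * B → ‖eval α P / α₀ ^ (d + 1)‖ ≤ ε := by
    rintro P ⟨hP, hPd⟩ hPB
    have h1 := norm_eval_le_mul_Isup hαi hP hPd (by positivity) hPB
    rw [norm_div, norm_pow, div_le_iff₀ (by positivity)]
    refine h1.trans ?_
    have e : ε * ‖α₀‖ ^ (d + 1) = (c + T) * B * S * (‖α₀‖ * (2 * C')) ^ (d + 1) := by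
      rw [hε_def, mul_pow]
      ring
    rw [e]
    exact le_mul_of_one_le_right (by positivity) (one_le_pow₀ hlow)
  set z := α₁ / α₀ - ξ with hz_def
  set v := η⁻¹ * (α₂ / α₀) with hv_def
  set f : ℕ → ℂ := fun i => eval α (dualPoly ξ η q d T i) / α₀ ^ d with hf_def
  have eX : eval α (X 0) = α₀ := by simp [α]
  have eU : eval α (linU ξ) = α₀ * z := by
    simp only [linU, map_sub, map_mul, eval_X, eval_C, hz_def, α]
    simp
    field_simp
  have eV : eval α (linV η) = α₀ * v := by
    simp only [linV, map_mul, eval_X, eval_C, hv_def, α]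
    simp
    field_simp
  have hz : ‖z‖ ≤ C' := by
    have : z = (α₁ - α₀ * ξ) / α₀ := by rw [hz_def]; field_simp
    rw [this, norm_div, div_le_iff₀ hα0pos]
    linarith
  have main := norm_sub_exp_le (z := z) (v := v) (f := f) (T := T) (by omega) hC hε hz ?_ ?_ ?_ ?_
  · have e : α₂ / α₀ - η * Complex.exp z = η * (v - Complex.exp z) := by
      rw [hv_def]; field_simp
    have hconst := pow_mul_const_le hc hC (hD.trans hDT) hDT
    have hrpow := pow_six_mul_le_rpow (hD.trans hDT)
    have hexp : Real.exp C' ≤ Real.exp (2 * C' ^ 2) := Real.exp_le_exp.mpr (by nlinarith)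
    rw [e, norm_mul]
    calc ‖η‖ * ‖v - Complex.exp z‖
        ≤ C' * (ε * (1 + C') ^ T * Real.exp C' * (3 * T ^ T)) := by gcongr
      _ = 3 * C' * Real.exp C' * ((c + T) * B * (2 * C') ^ (d + 1) *
            ((1 + C') ^ T * T ^ T)) * S := by rw [hε_def]; ring
      _ ≤ 3 * C' * Real.exp (2 * C' ^ 2) * (((2 * C' + 3) * (c * C') ^ 2) ^ T *
            (T : ℝ) ^ (6 * (T : ℝ) * Real.log T)) * S := by
          have h1 := hconst.trans (mul_le_mul_of_nonneg_left hrpow (by positivity))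
          gcongr
      _ = _ := by ring
  · have h := key _ (sub_X0_mul_dualPoly_zero_mem ξ hη hq hdq (by omega)) ?_
    · convert h using 2
      simp only [map_sub, map_mul, map_pow, eX, hf_def]
      field_simp
      ring
    · have h1 : plen (X 0 ^ (d + 1) : MvPolynomial (Fin 3) ℂ) ≤ 1 :=
        (plen_pow_le _ _).trans (by simp [plen_X])
      refine (plen_sub_le _ _).trans ((add_le_add h1 (hXQ 0)).trans ?_)
      nlinarith
  · intro i hi
    have h := key _ (linU_mul_dualPoly_sub_mem ξ hη hq hdq hi) ?_
    · convert h using 2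
      simp only [map_sub, map_mul, eX, eU, eval_C, hf_def]
      field_simp
      ring
    · have h1 : plen (C ((i : ℂ) + 1) * (X 0 * dualPoly ξ η q d T (i + 1))) ≤ T * B := by
        refine (plen_C_mul_le _ _).trans (mul_le_mul ?_ (hXQ _) (plen_nonneg _) (by positivity))
        rw [← Nat.cast_add_one, Complex.norm_natCast]
        exact_mod_cast hi.le
      refine (plen_sub_le _ _).trans ((add_le_add (hUQ i) h1).trans_eq ?_)
      ring
  · have h := key _ (linU_mul_dualPoly_last_mem ξ hη hq hdq (by omega)) ?_
    · convert h using 2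
      simp only [map_mul, eU, hf_def]
      field_simp
      ring
    · refine (hUQ _).trans ?_
      gcongr
      linarith
  · have h := key _ (linV_sub_sum_mem ξ hη hq hdq) ?_
    · convert h using 2
      simp only [map_sub, map_mul, map_sum, map_pow, eX, eV, hf_def, ← Finset.mul_sum,
        ← Finset.sum_div]
      field_simp
      ring
    · have h1 : plen (X 0 ^ d * linV η) ≤ 1 * c := by
        refine (plen_mul_le _ _).trans (mul_le_mul ?_ hcV (plen_nonneg _) zero_le_one)
        exact (plen_pow_le _ _).trans (by simp [plen_X])
      have h2 : plen (∑ i ∈ Finset.range T, X 0 * dualPoly ξ η q d T i) ≤ T * B := by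
        refine (plen_sum_le _ _).trans ?_
        simpa using Finset.sum_le_sum fun i (_ : i ∈ Finset.range T) => hXQ i
      refine (plen_sub_le _ _).trans ((add_le_add h1 h2).trans ?_)
      nlinarith
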